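/- Let (f, C) be an outside-obstacle representation of a finite simple graph G, let Z and Z' be cliques of G, and suppose G contains six vertices z1, z2, z3 ∈ Z and z1', z2', z3' ∈ Z' that induce the graph K*_6 with missing edges z1z1', z2z2', z3z3' (i.e., among these six vertices all pairs are adjacent except the three pairs z_i z_i'). Then the convex hulls CH(f({z1, z2, z3})) and CH(f({z1', z2', z3'})) are at least 1-crossing, and furthermore CH(f(Z)) and CH(f(Z')) are at least 1-crossing. -/

import Mathlib

noncomputable section

/-- The plane ℝ². -/
abbrev Plane : Type := EuclideanSpace ℝ (Fin 2)

/-- A point set is in general position if no three of its points are collinear. -/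
def InGenPos (P : Set Plane) : Prop :=
  ∀ p ∈ P, ∀ q ∈ P, ∀ r ∈ P, p ≠ q → p ≠ r → q ≠ r →
    ¬ Collinear ℝ ({p, q, r} : Set Plane)

/-- The union of the closed segments corresponding to the edges of `G`
in the straight-line drawing given by `f`. -/
def edgeUnion {V : Type} (G : SimpleGraph V) (f : V → Plane) : Set Plane :=
  ⋃ (u : V) (v : V) (_ : G.Adj u v), segment ℝ (f u) (f v)

/-- The unbounded connected component of the complement of the drawing. -/
def outsideRegion {V : Type} (G : SimpleGraph V) (f : V → Plane) : Set Plane :=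
  {p | p ∈ (edgeUnion G f)ᶜ ∧
       ¬ Bornology.IsBounded (connectedComponentIn (edgeUnion G f)ᶜ p)}

/-- `(f, C)` is a single-obstacle representation of `G`. -/
def IsObstacleRep {V : Type} (G : SimpleGraph V) (f : V → Plane) (C : Set Plane) : Prop :=
  Function.Injective f ∧ InGenPos (Set.range f) ∧
  IsOpen C ∧ IsConnected C ∧ Disjoint C (Set.range f) ∧
  ∀ u v : V, u ≠ v → (G.Adj u v ↔ Disjoint (segment ℝ (f u) (f v)) C)

/-- An outside-obstacle representation: the obstacle lies in the unbounded component. -/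
def IsOutsideObstacleRep {V : Type} (G : SimpleGraph V) (f : V → Plane) (C : Set Plane) : Prop :=
  IsObstacleRep G f C ∧ C ⊆ outsideRegion G f

/-- An inside-obstacle representation: the obstacle avoids the unbounded component. -/
def IsInsideObstacleRep {V : Type} (G : SimpleGraph V) (f : V → Plane) (C : Set Plane) : Prop :=
  IsObstacleRep G f C ∧ Disjoint C (outsideRegion G f)

/-- An exposed outside-obstacle representation: every vertex lies on the boundary of
the unbounded component. -/
def IsExposedOutsideObstacleRep {V : Type} (G : SimpleGraph V) (f : V → Plane)
    (C : Set Plane) : Prop :=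
  IsOutsideObstacleRep G f C ∧ ∀ v : V, f v ∈ closure (outsideRegion G f)

/-- `p` is an extreme point ("on the convex hull") of the point set `P`. -/
def IsExtremePt (p : Plane) (P : Set Plane) : Prop :=
  p ∉ convexHull ℝ (P \ {p})

/-- `S` has at least `n` connected components. -/
def AtLeastNComponents (S : Set Plane) (n : ℕ) : Prop :=
  ∃ p : Fin n → Plane, (∀ i, p i ∈ S) ∧
    ∀ i j : Fin n, i ≠ j →
      connectedComponentIn S (p i) ≠ connectedComponentIn S (p j)

/-- `S` has exactly `n` connected components. -/
def ExactlyNComponents (S : Set Plane) (n : ℕ) : Prop :=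
  ∃ p : Fin n → Plane, (∀ i, p i ∈ S) ∧
    (∀ i j : Fin n, i ≠ j →
      connectedComponentIn S (p i) ≠ connectedComponentIn S (p j)) ∧
    ∀ q ∈ S, ∃ i : Fin n, connectedComponentIn S q = connectedComponentIn S (p i)

/-- The convex hulls of `A` and `B` are at least `t`-crossing. -/
def AtLeastCrossing (A B : Set Plane) (t : ℕ) : Prop :=
  ((convexHull ℝ A) ∩ (convexHull ℝ B)).Nonempty ∧
    AtLeastNComponents ((convexHull ℝ A) \ (convexHull ℝ B)) (t + 1)

/-- The convex hulls of `A` and `B` are exactly `t`-crossing. -/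
def ExactlyCrossing (A B : Set Plane) (t : ℕ) : Prop :=
  ((convexHull ℝ A) ∩ (convexHull ℝ B)).Nonempty ∧
    ExactlyNComponents ((convexHull ℝ A) \ (convexHull ℝ B)) (t + 1)


/-- Orientation determinant of three points. -/
def ori (p q r : Plane) : ℝ := (q 0 - p 0) * (r 1 - p 1) - (q 1 - p 1) * (r 0 - p 0)

lemma ori_continuous (p q : Plane) : Continuous (fun k : Plane => ori p q k) := by
  unfold ori; fun_prop

lemma plane_ext {a b : Plane} (h0 : a 0 = b 0) (h1 : a 1 = b 1) : a = b := by
  ext i; fin_cases i <;> assumption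

/-- A point on the line through `p ≠ q` is an affine combination. -/
lemma exists_of_ori_eq_zero {p q r : Plane} (hpq : p ≠ q) (h : ori p q r = 0) :
    ∃ t : ℝ, r = (1 - t) • p + t • q := by
  unfold ori at h
  by_cases h0 : q 0 - p 0 = 0
  · have h1 : q 1 - p 1 ≠ 0 := by
      intro h1
      exact hpq (plane_ext (by linarith) (by linarith))
    refine ⟨(r 1 - p 1) / (q 1 - p 1), plane_ext ?_ ?_⟩
    · have : r 0 - p 0 = 0 := by
        rw [h0] at h
        have : (q 1 - p 1) * (r 0 - p 0) = 0 := by linarith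
        exact (mul_eq_zero.mp this).resolve_left h1
      simp only [PiLp.add_apply, PiLp.smul_apply, smul_eq_mul]
      have h2 : q 0 = p 0 := by linarith
      rw [h2]; linarith
    · simp only [PiLp.add_apply, PiLp.smul_apply, smul_eq_mul]
      field_simp; ring
  · refine ⟨(r 0 - p 0) / (q 0 - p 0), plane_ext ?_ ?_⟩
    · simp only [PiLp.add_apply, PiLp.smul_apply, smul_eq_mul]
      field_simp; ring
    · simp only [PiLp.add_apply, PiLp.smul_apply, smul_eq_mul]
      field_simp; linarith

lemma collinear_of_ori {p q r : Plane} (hpq : p ≠ q) (h : ori p q r = 0) :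
    Collinear ℝ ({p, q, r} : Set Plane) := by
  obtain ⟨t, ht⟩ := exists_of_ori_eq_zero hpq h
  rw [collinear_iff_of_mem (p₀ := p) (by simp)]
  refine ⟨q - p, ?_⟩
  intro w hw
  simp only [Set.mem_insert_iff, Set.mem_singleton_iff] at hw
  rcases hw with rfl | rfl | rfl
  · exact ⟨0, by simp⟩
  · exact ⟨1, by simp⟩
  · refine ⟨t, ?_⟩
    rw [ht, vadd_eq_add]; module

/-- Two segments whose end points separate each other cross. -/
lemma cross_point {p q r s : Plane} (h1 : ori p q r * ori p q s < 0)
    (h2 : ori r s p * ori r s q < 0) :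
    ∃ (t u : ℝ), 0 < t ∧ t < 1 ∧ 0 < u ∧ u < 1 ∧
      (1 - t) • r + t • s = (1 - u) • p + u • q := by
  have key : ∀ a b : ℝ, a * b < 0 → a - b ≠ 0 ∧ 0 < a / (a - b) ∧ a / (a - b) < 1 := by
    intro a b hab
    rcases mul_neg_iff.mp hab with ⟨ha, hb⟩ | ⟨ha, hb⟩
    · have : 0 < a - b := by linarith
      exact ⟨this.ne', div_pos ha this, by rw [div_lt_one this]; linarith⟩
    · have : a - b < 0 := by linarith
      exact ⟨this.ne, div_pos_of_neg_of_neg ha this, by rw [div_lt_one_of_neg this]; linarith⟩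
  obtain ⟨n1, a1, b1⟩ := key _ _ h1
  obtain ⟨n2, a2, b2⟩ := key _ _ h2
  refine ⟨_, _, a1, b1, a2, b2, ?_⟩
  unfold ori at *
  apply plane_ext
  · simp only [PiLp.add_apply, PiLp.smul_apply, smul_eq_mul]
    field_simp; ring
  · simp only [PiLp.add_apply, PiLp.smul_apply, smul_eq_mul]
    field_simp; ring

lemma no_escape {E K : Set Plane} (hKc : IsClosed K) (hKb : Bornology.IsBounded K)
    (hK : ∀ k ∈ K, k ∈ E ∨ k ∈ interior K) {c : Plane} (hc : c ∈ K) (hcE : c ∈ Eᶜ)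
    (hub : ¬ Bornology.IsBounded (connectedComponentIn Eᶜ c)) : False := by
  have hcS := mem_connectedComponentIn hcE
  have hne : (connectedComponentIn Eᶜ c ∩ Kᶜ).Nonempty := by
    by_contra h
    rw [Set.not_nonempty_iff_eq_empty, ← Set.disjoint_iff_inter_eq_empty,
      Set.disjoint_compl_right_iff_subset] at h
    exact hub (hKb.subset h)
  have hci : c ∈ interior K := (hK c hc).resolve_left hcE
  obtain ⟨w, -, hw1, hw2⟩ := isPreconnected_connectedComponentIn (interior K) Kᶜ
    isOpen_interior hKc.isOpen_compl (by
      intro w hw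
      by_cases hwK : w ∈ K
      · exact Or.inl ((hK w hwK).resolve_left (connectedComponentIn_subset _ _ hw))
      · exact Or.inr hwK) ⟨c, hcS, hci⟩ hne
  exact hw2 (interior_subset hw1)

/-- Closed triangle, by inequalities. -/
def tri (p q y : Plane) : Set Plane :=
  {k | 0 ≤ ori p q k ∧ 0 ≤ ori q y k ∧ 0 ≤ ori y p k}

lemma tri_closed (p q y : Plane) : IsClosed (tri p q y) :=
  (isClosed_le continuous_const (ori_continuous _ _)).inter
    ((isClosed_le continuous_const (ori_continuous _ _)).inter
      (isClosed_le continuous_const (ori_continuous _ _)))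

lemma bary {p q y : Plane} (h : 0 < ori p q y) (k : Plane) :
    (ori q y k / ori p q y) • p + (ori y p k / ori p q y) • q + (ori p q k / ori p q y) • y = k
    ∧ ori q y k / ori p q y + ori y p k / ori p q y + ori p q k / ori p q y = 1 := by
  have hne := h.ne'
  unfold ori at *
  refine ⟨plane_ext ?_ ?_, ?_⟩
  · simp only [PiLp.add_apply, PiLp.smul_apply, smul_eq_mul]
    field_simp; ring
  · simp only [PiLp.add_apply, PiLp.smul_apply, smul_eq_mul]
    field_simp; ring
  · field_simp; ring

lemma ori_rot (p q r : Plane) : ori q r p = ori p q r := by unfold ori; ring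

lemma ori_swap (p q r : Plane) : ori q p r = - ori p q r := by unfold ori; ring

lemma ori_swap' (p q r : Plane) : ori p r q = - ori p q r := by unfold ori; ring

lemma tri_bounded {p q y : Plane} (h : 0 < ori p q y) : Bornology.IsBounded (tri p q y) := by
  have hb : Bornology.IsBounded (convexHull ℝ ({p, q, y} : Set Plane)) :=
    isBounded_convexHull.mpr (Set.toFinite _).isBounded
  refine hb.subset ?_
  rintro k ⟨h1, h2, h3⟩
  obtain ⟨e1, e2⟩ := bary h k
  rw [← e1]
  have hp : p ∈ convexHull ℝ ({p, q, y} : Set Plane) := subset_convexHull _ _ (by simp)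
  have hq : q ∈ convexHull ℝ ({p, q, y} : Set Plane) := subset_convexHull _ _ (by simp)
  have hy : y ∈ convexHull ℝ ({p, q, y} : Set Plane) := subset_convexHull _ _ (by simp)
  have hc := convex_convexHull ℝ ({p, q, y} : Set Plane)
  have := hc.sum_mem (t := (Finset.univ : Finset (Fin 3)))
    (w := ![ori q y k / ori p q y, ori y p k / ori p q y, ori p q k / ori p q y])
    (z := ![p, q, y]) (by
      intro i _
      fin_cases i <;> simp <;> positivity) (by simpa [Fin.sum_univ_three] using e2) (by
      intro i _
      fin_cases i <;> simpa)
  simpa [Fin.sum_univ_three] using this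

/-- a point of the triangle on the line of one side lies on that side -/
lemma tri_side {p q y : Plane} (h : 0 < ori p q y) {k : Plane} (hk : k ∈ tri p q y)
    (h0 : ori p q k = 0) : k ∈ segment ℝ p q := by
  obtain ⟨e1, e2⟩ := bary h k
  obtain ⟨h1, h2, h3⟩ := hk
  rw [h0] at e1 e2
  refine ⟨_, _, div_nonneg h2 h.le, div_nonneg h3 h.le, by simpa using e2, by simpa using e1⟩

lemma tri_rot {p q y k : Plane} (hk : k ∈ tri p q y) : k ∈ tri q y p :=
  ⟨hk.2.1, hk.2.2, hk.1⟩

lemma tri_no_escape {E : Set Plane} {p q y : Plane} (h : 0 < ori p q y)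
    (e1 : segment ℝ p q ⊆ E) (e2 : segment ℝ q y ⊆ E) (e3 : segment ℝ y p ⊆ E)
    {c : Plane} (hc : c ∈ tri p q y) (hcE : c ∈ Eᶜ)
    (hub : ¬ Bornology.IsBounded (connectedComponentIn Eᶜ c)) : False := by
  refine no_escape (tri_closed p q y) (tri_bounded h) ?_ hc hcE hub
  intro k hk
  have hr1 : 0 < ori q y p := by rw [ori_rot]; exact h
  have hr2 : 0 < ori y p q := by rw [ori_rot]; exact hr1
  rcases hk.1.eq_or_lt with h1 | h1
  · exact Or.inl (e1 (tri_side h hk h1.symm))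
  rcases hk.2.1.eq_or_lt with h2 | h2
  · exact Or.inl (e2 (tri_side hr1 (tri_rot hk) h2.symm))
  rcases hk.2.2.eq_or_lt with h3 | h3
  · exact Or.inl (e3 (tri_side hr2 (tri_rot (tri_rot hk)) h3.symm))
  right
  refine mem_interior.mpr ⟨{k | 0 < ori p q k ∧ 0 < ori q y k ∧ 0 < ori y p k}, ?_, ?_, h1, h2, h3⟩
  · rintro w ⟨a, b, c⟩
    exact ⟨a.le, b.le, c.le⟩
  · exact (isOpen_lt continuous_const (ori_continuous _ _)).inter
      ((isOpen_lt continuous_const (ori_continuous _ _)).inter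
        (isOpen_lt continuous_const (ori_continuous _ _)))

/-- key step of the diamond lemma -/
lemma diamond_half {E : Set Plane} {p q x y : Plane} (hy : 0 < ori p q y) (hx : 0 < ori q p x)
    (e2 : segment ℝ q y ⊆ E) (e3 : segment ℝ y p ⊆ E)
    {k : Plane} (hk : k ∈ tri p q y) :
    k ∈ E ∨ k ∈ interior (tri p q y ∪ tri q p x) := by
  have hr1 : 0 < ori q y p := by rw [ori_rot]; exact hy
  have hr2 : 0 < ori y p q := by rw [ori_rot]; exact hr1
  rcases hk.2.1.eq_or_lt with h2 | h2
  · exact Or.inl (e2 (tri_side hr1 (tri_rot hk) h2.symm))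
  rcases hk.2.2.eq_or_lt with h3 | h3
  · exact Or.inl (e3 (tri_side hr2 (tri_rot (tri_rot hk)) h3.symm))
  right
  rcases hk.1.eq_or_lt with h1 | h1
  · obtain ⟨e1, e2⟩ := bary hy k
    rw [← h1] at e1 e2
    set α := ori q y k / ori p q y with hα
    set β := ori y p k / ori p q y with hβ
    have hαp : 0 < α := div_pos h2 hy
    have hβp : 0 < β := div_pos h3 hy
    have hsum : α = 1 - β := by simp at e2; linarith
    have ek : k = α • p + β • q := by simpa using e1.symm
    have g1 : ori p x k = β * ori q p x := by
      rw [ek, hsum]; unfold ori; simp only [PiLp.add_apply, PiLp.smul_apply, smul_eq_mul]; ring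
    have g2 : ori x q k = α * ori q p x := by
      have hb : β = 1 - α := by linarith
      rw [ek, hb]; unfold ori; simp only [PiLp.add_apply, PiLp.smul_apply, smul_eq_mul]; ring
    refine mem_interior.mpr ⟨{k | (0 < ori q y k ∧ 0 < ori y p k) ∧ (0 < ori p x k ∧ 0 < ori x q k)},
      ?_, ?_, ⟨h2, h3⟩, ?_, ?_⟩
    · rintro w ⟨⟨a, b⟩, c, d⟩
      rcases le_total 0 (ori p q w) with h | h
      · exact Or.inl ⟨h, a.le, b.le⟩
      · exact Or.inr ⟨by rw [ori_swap]; linarith, c.le, d.le⟩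
    · exact ((isOpen_lt continuous_const (ori_continuous _ _)).inter
        (isOpen_lt continuous_const (ori_continuous _ _))).inter
        ((isOpen_lt continuous_const (ori_continuous _ _)).inter
        (isOpen_lt continuous_const (ori_continuous _ _)))
    · rw [g1]; positivity
    · rw [g2]; positivity
  · refine mem_interior.mpr
      ⟨{k | 0 < ori p q k ∧ 0 < ori q y k ∧ 0 < ori y p k}, ?_, ?_, h1, h2, h3⟩
    · rintro w ⟨a, b, c⟩
      exact Or.inl ⟨a.le, b.le, c.le⟩
    · exact (isOpen_lt continuous_const (ori_continuous _ _)).inter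
        ((isOpen_lt continuous_const (ori_continuous _ _)).inter
          (isOpen_lt continuous_const (ori_continuous _ _)))

lemma seg_tri {p q y c : Plane} (h : 0 < ori p q y) (hc : c ∈ segment ℝ p q) :
    c ∈ tri p q y := by
  obtain ⟨a, b, ha, hb, hab, rfl⟩ := hc
  have hA : a = 1 - b := by linarith
  have hB : b = 1 - a := by linarith
  refine ⟨?_, ?_, ?_⟩
  · have : ori p q (a • p + b • q) = 0 := by
      rw [hA]; unfold ori; simp only [PiLp.add_apply, PiLp.smul_apply, smul_eq_mul]; ring
    exact this.ge
  · have : ori q y (a • p + b • q) = a * ori p q y := by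
      rw [hB]; unfold ori; simp only [PiLp.add_apply, PiLp.smul_apply, smul_eq_mul]; ring
    rw [this]; positivity
  · have : ori y p (a • p + b • q) = b * ori p q y := by
      rw [hA]; unfold ori; simp only [PiLp.add_apply, PiLp.smul_apply, smul_eq_mul]; ring
    rw [this]; positivity

lemma diamond {E : Set Plane} {p q x y : Plane} (hxy : ori p q x * ori p q y < 0)
    (e1 : segment ℝ p x ⊆ E) (e2 : segment ℝ x q ⊆ E)
    (e3 : segment ℝ q y ⊆ E) (e4 : segment ℝ y p ⊆ E)
    {c : Plane} (hc : c ∈ segment ℝ p q) (hcE : c ∈ Eᶜ)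
    (hub : ¬ Bornology.IsBounded (connectedComponentIn Eᶜ c)) : False := by
  wlog h : 0 < ori p q y generalizing x y
  · refine this (x := y) (y := x) (by rw [mul_comm]; exact hxy) (by rwa [segment_symm])
      (by rwa [segment_symm]) (by rwa [segment_symm]) (by rwa [segment_symm]) ?_
    rcases mul_neg_iff.mp hxy with h' | h'
    · exact h'.1
    · exact absurd h'.2 h
  have hx : 0 < ori q p x := by
    rw [ori_swap]
    rcases mul_neg_iff.mp hxy with h' | h'
    · linarith [h'.2]
    · linarith [h'.1]
  refine no_escape ((tri_closed p q y).union (tri_closed q p x))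
    ((tri_bounded h).union (tri_bounded hx)) ?_ (Or.inl (seg_tri h hc)) hcE hub
  rintro k (hk | hk)
  · exact diamond_half h hx e3 e4 hk
  · rw [Set.union_comm]
    exact diamond_half hx h e1 e2 hk

lemma hull_three {p q y c : Plane} (h : 0 < ori p q y)
    (hc : c ∈ convexHull ℝ ({p, q, y} : Set Plane)) : c ∈ tri p q y := by
  have hconv : Convex ℝ (tri p q y) := by
    have aux : ∀ a b : Plane, Convex ℝ {k | 0 ≤ ori a b k} := by
      intro a b k hk l hl s t hs ht hst
      have : ori a b (s • k + t • l) = s * ori a b k + t * ori a b l := by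
        have : s = 1 - t := by linarith
        rw [this]; unfold ori; simp only [PiLp.add_apply, PiLp.smul_apply, smul_eq_mul]; ring
      simp only [Set.mem_ofPred_eq] at *
      rw [this]; positivity
    exact (aux _ _).inter ((aux _ _).inter (aux _ _))
  refine convexHull_min ?_ hconv hc
  intro w hw
  simp only [Set.mem_insert_iff, Set.mem_singleton_iff] at hw
  have hr1 : 0 < ori q y p := by rw [ori_rot]; exact h
  rcases hw with rfl | rfl | rfl
  · exact seg_tri h (left_mem_segment _ _ _)
  · exact seg_tri h (right_mem_segment _ _ _)
  · exact tri_rot (tri_rot (seg_tri hr1 (right_mem_segment _ _ _)))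

/-- Two convex hulls with crossing chords are at least 1-crossing. -/
lemma crossing_of_chords {A B : Set Plane} {a0 a1 b0 b1 : Plane}
    (ha0 : a0 ∈ A) (ha1 : a1 ∈ A) (hb0 : b0 ∈ B) (hb1 : b1 ∈ B)
    (na0 : a0 ∉ convexHull ℝ B) (na1 : a1 ∉ convexHull ℝ B)
    (nb0 : b0 ∉ convexHull ℝ A) (nb1 : b1 ∉ convexHull ℝ A)
    (h1 : ori a0 a1 b0 * ori a0 a1 b1 < 0) (h2 : ori b0 b1 a0 * ori b0 b1 a1 < 0) :
    AtLeastCrossing A B 1 := by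
  have hA := convex_convexHull ℝ A
  have hB := convex_convexHull ℝ B
  have ha0 := subset_convexHull ℝ A ha0
  have ha1 := subset_convexHull ℝ A ha1
  have hb0 := subset_convexHull ℝ B hb0
  have hb1 := subset_convexHull ℝ B hb1
  obtain ⟨t, u, t0, t1, u0, u1, e⟩ := cross_point h1 h2
  have hxA : (1 - t) • b0 + t • b1 ∈ convexHull ℝ A := by
    rw [e]; exact hA ha0 ha1 (by linarith) u0.le (by ring)
  have hxB : (1 - t) • b0 + t • b1 ∈ convexHull ℝ B :=
    hB hb0 hb1 (by linarith) t0.le (by ring)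
  have hbne : b0 ≠ b1 := by
    rintro rfl
    simp [ori] at h2
  have main : connectedComponentIn (convexHull ℝ A \ convexHull ℝ B) a0 ≠
      connectedComponentIn (convexHull ℝ A \ convexHull ℝ B) a1 := by
    intro heq
    have m0 : a0 ∈ connectedComponentIn (convexHull ℝ A \ convexHull ℝ B) a0 :=
      mem_connectedComponentIn ⟨ha0, na0⟩
    have m1 : a1 ∈ connectedComponentIn (convexHull ℝ A \ convexHull ℝ B) a0 := by
      rw [heq]; exact mem_connectedComponentIn ⟨ha1, na1⟩
    have hpc : IsPreconnected (connectedComponentIn (convexHull ℝ A \ convexHull ℝ B) a0) :=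
      isPreconnected_connectedComponentIn
    have hcont := (ori_continuous b0 b1).continuousOn
      (s := connectedComponentIn (convexHull ℝ A \ convexHull ℝ B) a0)
    have : ∃ w ∈ connectedComponentIn (convexHull ℝ A \ convexHull ℝ B) a0, ori b0 b1 w = 0 := by
      rcases mul_neg_iff.mp h2 with ⟨p, n⟩ | ⟨n, p⟩
      · exact hpc.intermediate_value m1 m0 hcont ⟨n.le, p.le⟩
      · exact hpc.intermediate_value m0 m1 hcont ⟨n.le, p.le⟩
    obtain ⟨w, hw, hw0⟩ := this
    obtain ⟨hwA, hwB⟩ := connectedComponentIn_subset _ _ hw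
    obtain ⟨s, hs⟩ := exists_of_ori_eq_zero hbne hw0
    rcases lt_or_ge s 0 with s0 | s0
    · apply nb0
      have hpos : 0 < t - s := by linarith
      have := hA hwA hxA (a := t / (t - s)) (b := -s / (t - s))
        (div_nonneg t0.le hpos.le) (div_nonneg (by linarith) hpos.le) (by field_simp; ring)
      convert this using 1
      rw [hs]
      apply plane_ext <;> simp only [PiLp.add_apply, PiLp.smul_apply, smul_eq_mul] <;>
        field_simp <;> ring
    rcases lt_or_ge 1 s with s1 | s1
    · apply nb1
      have hpos : 0 < s - t := by linarith
      have := hA hwA hxA (a := (1 - t) / (s - t)) (b := (s - 1) / (s - t))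
        (div_nonneg (by linarith) hpos.le) (div_nonneg (by linarith) hpos.le) (by field_simp; ring)
      convert this using 1
      rw [hs]
      apply plane_ext <;> simp only [PiLp.add_apply, PiLp.smul_apply, smul_eq_mul] <;>
        field_simp <;> ring
    · apply hwB
      rw [hs]
      exact hB hb0 hb1 (by linarith) s0 (by ring)
  refine ⟨⟨_, hxA, hxB⟩, ![a0, a1], ?_, ?_⟩
  · intro i
    fin_cases i
    · exact ⟨ha0, na0⟩
    · exact ⟨ha1, na1⟩
  · intro i j hij
    fin_cases i <;> fin_cases j
    · exact absurd rfl hij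
    · exact main
    · exact main.symm
    · exact absurd rfl hij

lemma seg_subset_edge {V : Type} {G : SimpleGraph V} {f : V → Plane} {u v : V}
    (h : G.Adj u v) : segment ℝ (f u) (f v) ⊆ edgeUnion G f := by
  intro w hw
  simp only [edgeUnion, Set.mem_iUnion]
  exact ⟨u, v, h, hw⟩

lemma ori_ne {V : Type} {G : SimpleGraph V} {f : V → Plane} {C : Set Plane}
    (hrep : IsOutsideObstacleRep G f C) {u v w : V} (h1 : u ≠ v) (h2 : u ≠ w) (h3 : v ≠ w) :
    ori (f u) (f v) (f w) ≠ 0 := by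
  intro h
  have hinj := hrep.1.1
  exact hrep.1.2.1 _ ⟨u, rfl⟩ _ ⟨v, rfl⟩ _ ⟨w, rfl⟩ (hinj.ne h1) (hinj.ne h2) (hinj.ne h3)
    (collinear_of_ori (hinj.ne h1) h)

/-- The obstacle misses the convex hull of any clique. -/
lemma obstacle_clique {V : Type} {G : SimpleGraph V} {f : V → Plane} {C : Set Plane}
    (hrep : IsOutsideObstacleRep G f C) {Z : Set V} (hZ : Z.Pairwise G.Adj) {c : Plane}
    (hcC : c ∈ C) (hc : c ∈ convexHull ℝ (f '' Z)) : False := by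
  have hout := hrep.2 hcC
  rw [convexHull_eq_union] at hc
  simp only [Set.mem_iUnion] at hc
  obtain ⟨t, hts, hai, hct⟩ := hc
  have hcard : t.card ≤ 3 := by
    have := hai.card_le_finrank_succ
    have h2 := Submodule.finrank_le (vectorSpan ℝ (Set.range ((↑) : t → Plane)))
    simp only [Fintype.card_coe] at this
    have h3 : Module.finrank ℝ Plane = 2 := by simp [Plane]
    omega
  interval_cases ht : t.card
  · rw [Finset.card_eq_zero] at ht
    subst ht
    simp at hct
  · obtain ⟨a, rfl⟩ := Finset.card_eq_one.mp ht
    simp only [Finset.coe_singleton, convexHull_singleton, Set.mem_singleton_iff] at hct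
    subst hct
    obtain ⟨u, -, hu⟩ := hts (by simp : c ∈ _)
    exact Set.disjoint_left.mp hrep.1.2.2.2.2.1 hcC ⟨u, hu⟩
  · obtain ⟨a, b, hab, rfl⟩ := Finset.card_eq_two.mp ht
    obtain ⟨u, huZ, rfl⟩ := hts (by simp : a ∈ _)
    obtain ⟨v, hvZ, rfl⟩ := hts (by simp : b ∈ _)
    have huv : u ≠ v := fun h => hab (by rw [h])
    simp only [Finset.coe_insert, Finset.coe_singleton, convexHull_pair] at hct
    exact hout.1 (seg_subset_edge (hZ huZ hvZ huv) hct)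
  · obtain ⟨a, b, d, hab, had, hbd, rfl⟩ := Finset.card_eq_three.mp ht
    obtain ⟨u, huZ, rfl⟩ := hts (by simp : a ∈ _)
    obtain ⟨v, hvZ, rfl⟩ := hts (by simp : b ∈ _)
    obtain ⟨w, hwZ, rfl⟩ := hts (by simp : d ∈ _)
    have huv : u ≠ v := fun h => hab (by rw [h])
    have huw : u ≠ w := fun h => had (by rw [h])
    have hvw : v ≠ w := fun h => hbd (by rw [h])
    simp only [Finset.coe_insert, Finset.coe_singleton] at hct
    rcases (ori_ne hrep huv huw hvw).lt_or_gt with h | h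
    · have h' : 0 < ori (f v) (f u) (f w) := by rw [ori_swap]; linarith
      rw [Set.insert_comm] at hct
      exact tri_no_escape h' (seg_subset_edge (hZ hvZ huZ huv.symm))
        (seg_subset_edge (hZ huZ hwZ huw)) (seg_subset_edge (hZ hwZ hvZ hvw.symm))
        (hull_three h' hct) hout.1 hout.2
    · exact tri_no_escape h (seg_subset_edge (hZ huZ hvZ huv))
        (seg_subset_edge (hZ hvZ hwZ hvw)) (seg_subset_edge (hZ hwZ huZ huw.symm))
        (hull_three h hct) hout.1 hout.2

lemma sub_segment_left {p q : Plane} {t : ℝ} (h0 : 0 ≤ t) (h1 : t ≤ 1) :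
    segment ℝ p ((1 - t) • p + t • q) ⊆ segment ℝ p q :=
  (convex_segment p q).segment_subset (left_mem_segment _ _ _)
    ⟨1 - t, t, by linarith, h0, by ring, rfl⟩

lemma sub_segment_right {p q : Plane} {t : ℝ} (h0 : 0 ≤ t) (h1 : t ≤ 1) :
    segment ℝ ((1 - t) • p + t • q) q ⊆ segment ℝ p q :=
  (convex_segment p q).segment_subset
    ⟨1 - t, t, by linarith, h0, by ring, rfl⟩ (right_mem_segment _ _ _)

lemma sgn_aux {a b c : ℝ} (h1 : 0 < a * b) (h2 : a * c < 0) : c * b < 0 := by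
  rcases mul_pos_iff.mp h1 with ⟨ha, hb⟩ | ⟨ha, hb⟩
  · exact mul_neg_of_neg_of_pos (neg_of_mul_neg_right h2 ha.le) hb
  · exact mul_neg_of_pos_of_neg (pos_of_mul_neg_right h2 ha.le) hb

/-- The crossing point in the parallel case. -/
lemma parallel_point {E : Set Plane} {a b a' b' : Plane}
    (s1 : 0 < ori a b a' * ori a b b') (s2 : 0 < ori a' b' a * ori a' b' b)
    (s3 : ori a b a' * ori a' b' a < 0)
    (e1 : segment ℝ a b' ⊆ E) (e2 : segment ℝ a' b ⊆ E) :
    ∃ x, segment ℝ a x ⊆ E ∧ segment ℝ x b ⊆ E ∧ 0 < ori a b x * ori a b a' := by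
  have h1 : ori a b' a' * ori a b' b < 0 := by
    have r1 : ori a b' a' = - ori a' b' a := by unfold ori; ring
    have r2 : ori a b' b = - ori a b b' := by unfold ori; ring
    rw [r1, r2]
    have := sgn_aux s1 s3
    linarith
  have h2 : ori a' b a * ori a' b b' < 0 := by
    have r1 : ori a' b a = - ori a b a' := by unfold ori; ring
    have r2 : ori a' b b' = - ori a' b' b := by unfold ori; ring
    rw [r1, r2]
    have := sgn_aux s2 (c := ori a b a') (by linarith)
    linarith
  obtain ⟨t, u, t0, t1, u0, u1, e⟩ := cross_point h1 h2
  refine ⟨(1 - u) • a + u • b', (sub_segment_left u0.le u1.le).trans e1, ?_, ?_⟩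
  · rw [← e]
    exact (sub_segment_right t0.le t1.le).trans e2
  · have : ori a b ((1 - u) • a + u • b') = u * ori a b b' := by
      unfold ori; simp only [PiLp.add_apply, PiLp.smul_apply, smul_eq_mul]; ring
    rw [this]
    nlinarith [mul_pos u0 s1]

/-- In an outside-obstacle representation, if cliques `Z, Z'` contain
six vertices inducing `K₆*` (a `K₆` minus the perfect matching `z i — z' i`), then the
convex hulls of the images of `{z 0, z 1, z 2}` and `{z' 0, z' 1, z' 2}` are at least
1-crossing, and so are the convex hulls of the images of `Z` and `Z'`. -/
theorem K6star_forces_crossing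
    {V : Type} [Fintype V] (G : SimpleGraph V) (f : V → Plane) (C : Set Plane)
    (hrep : IsOutsideObstacleRep G f C) (Z Z' : Set V)
    (hZ : Z.Pairwise G.Adj) (hZ' : Z'.Pairwise G.Adj)
    (z z' : Fin 3 → V)
    (hzZ : ∀ i, z i ∈ Z) (hz'Z' : ∀ i, z' i ∈ Z')
    (hdistinct : Function.Injective (Sum.elim z z' : Fin 3 ⊕ Fin 3 → V))
    (hcrossadj : ∀ i j : Fin 3, i ≠ j → G.Adj (z i) (z' j))
    (hmatchnon : ∀ i : Fin 3, ¬ G.Adj (z i) (z' i)) :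
    AtLeastCrossing (f '' Set.range z) (f '' Set.range z') 1 ∧
    AtLeastCrossing (f '' Z) (f '' Z') 1 := by
  have hinj : ∀ x y : Fin 3 ⊕ Fin 3, x ≠ y → Sum.elim z z' x ≠ Sum.elim z z' y :=
    fun x y h => hdistinct.ne h
  have nzz : ∀ i j, i ≠ j → z i ≠ z j := fun i j h => hinj (.inl i) (.inl j) (by simpa using h)
  have nzz' : ∀ i j, i ≠ j → z' i ≠ z' j := fun i j h => hinj (.inr i) (.inr j) (by simpa using h)
  have nzc : ∀ i j, z i ≠ z' j := fun i j => hinj (.inl i) (.inr j) (by simp)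
  have hmeet : ∀ i, ∃ c ∈ C, c ∈ segment ℝ (f (z i)) (f (z' i)) := by
    intro i
    have := mt (hrep.1.2.2.2.2.2 (z i) (z' i) (nzc i i)).mpr (hmatchnon i)
    obtain ⟨c, hc1, hc2⟩ := Set.not_disjoint_iff.mp this
    exact ⟨c, hc2, hc1⟩
  have aZ : ∀ i j, i ≠ j → segment ℝ (f (z i)) (f (z j)) ⊆ edgeUnion G f := fun i j h =>
    seg_subset_edge (hZ (hzZ i) (hzZ j) (nzz i j h))
  have aZ' : ∀ i j, i ≠ j → segment ℝ (f (z' i)) (f (z' j)) ⊆ edgeUnion G f := fun i j h =>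
    seg_subset_edge (hZ' (hz'Z' i) (hz'Z' j) (nzz' i j h))
  have aC : ∀ i j, i ≠ j → segment ℝ (f (z i)) (f (z' j)) ⊆ edgeUnion G f := fun i j h =>
    seg_subset_edge (hcrossadj i j h)
  -- vertices of one clique are outside the hull of the other
  have outZ' : ∀ i, f (z' i) ∉ convexHull ℝ (f '' Z) := by
    intro i hi
    obtain ⟨c, hcC, hc⟩ := hmeet i
    exact obstacle_clique hrep hZ hcC ((convex_convexHull ℝ _).segment_subset
      (subset_convexHull ℝ _ (Set.mem_image_of_mem f (hzZ i))) hi hc)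
  have outZ : ∀ i, f (z i) ∉ convexHull ℝ (f '' Z') := by
    intro i hi
    obtain ⟨c, hcC, hc⟩ := hmeet i
    exact obstacle_clique hrep hZ' hcC ((convex_convexHull ℝ _).segment_subset
      hi (subset_convexHull ℝ _ (Set.mem_image_of_mem f (hz'Z' i))) hc)
  have subZ : convexHull ℝ (f '' Set.range z) ⊆ convexHull ℝ (f '' Z) :=
    convexHull_mono (Set.image_mono (by rintro _ ⟨i, rfl⟩; exact hzZ i))
  have subZ' : convexHull ℝ (f '' Set.range z') ⊆ convexHull ℝ (f '' Z') :=
    convexHull_mono (Set.image_mono (by rintro _ ⟨i, rfl⟩; exact hz'Z' i))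
  have same : ∀ i j, i ≠ j → 0 < ori (f (z i)) (f (z' i)) (f (z j)) *
      ori (f (z i)) (f (z' i)) (f (z' j)) := by
    intro i j hij
    have n1 := ori_ne hrep (nzc i i) (nzz i j hij) (nzc j i).symm
    have n2 := ori_ne hrep (nzc i i) (nzc i j) (nzz' i j hij)
    by_contra hcon
    have hlt := lt_of_le_of_ne (not_lt.mp hcon) (mul_ne_zero n1 n2)
    obtain ⟨c, hcC, hc⟩ := hmeet i
    have hout := hrep.2 hcC
    exact diamond hlt (aZ i j hij) (aC j i hij.symm) (aZ' i j hij)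
      (by rw [segment_symm]; exact aC i j hij) hc hout.1 hout.2
  have nP : ∀ i j, i ≠ j → ori (f (z i)) (f (z' i)) (f (z j)) ≠ 0 := fun i j hij =>
    ori_ne hrep (nzc i i) (nzz i j hij) (nzc j i).symm
  by_cases hex : ∃ i j, i ≠ j ∧ 0 < ori (f (z i)) (f (z' i)) (f (z j)) *
      ori (f (z j)) (f (z' j)) (f (z i))
  · obtain ⟨i, j, hij, hpos⟩ := hex
    have si := same i j hij
    have sj := same j i hij.symm
    have h1 : ori (f (z i)) (f (z j)) (f (z' i)) * ori (f (z i)) (f (z j)) (f (z' j)) < 0 := by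
      have r1 : ori (f (z i)) (f (z j)) (f (z' i)) = - ori (f (z i)) (f (z' i)) (f (z j)) :=
        ori_swap' _ _ _
      have r2 : ori (f (z i)) (f (z j)) (f (z' j)) = ori (f (z j)) (f (z' j)) (f (z i)) :=
        (ori_rot _ _ _).symm
      rw [r1, r2]; linarith
    have h2 : ori (f (z' i)) (f (z' j)) (f (z i)) * ori (f (z' i)) (f (z' j)) (f (z j)) < 0 := by
      have r1 : ori (f (z' i)) (f (z' j)) (f (z i)) = ori (f (z i)) (f (z' i)) (f (z' j)) :=
        ori_rot _ _ _
      have r2 : ori (f (z' i)) (f (z' j)) (f (z j)) = - ori (f (z j)) (f (z' j)) (f (z' i)) := by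
        unfold ori; ring
      rw [r1, r2]
      by_contra hcon
      have hm := mul_pos (mul_pos si sj) hpos
      nlinarith [mul_pos si sj, mul_self_nonneg (ori (f (z i)) (f (z' i)) (f (z j)) *
        ori (f (z j)) (f (z' j)) (f (z i)))]
    exact ⟨crossing_of_chords ⟨_, ⟨i, rfl⟩, rfl⟩ ⟨_, ⟨j, rfl⟩, rfl⟩ ⟨_, ⟨i, rfl⟩, rfl⟩
        ⟨_, ⟨j, rfl⟩, rfl⟩ (fun h => outZ i (subZ' h)) (fun h => outZ j (subZ' h))
        (fun h => outZ' i (subZ h)) (fun h => outZ' j (subZ h)) h1 h2,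
      crossing_of_chords ⟨_, hzZ i, rfl⟩ ⟨_, hzZ j, rfl⟩ ⟨_, hz'Z' i, rfl⟩
        ⟨_, hz'Z' j, rfl⟩ (outZ i) (outZ j) (outZ' i) (outZ' j) h1 h2⟩
  · exfalso
    push Not at hex
    have anti : ∀ i j, i ≠ j → ori (f (z i)) (f (z' i)) (f (z j)) *
        ori (f (z j)) (f (z' j)) (f (z i)) < 0 := fun i j hij =>
      lt_of_le_of_ne (hex i j hij) (mul_ne_zero (nP i j hij) (nP j i hij.symm))
    -- some missing edge separates the two others
    have mid : ∃ i j k, i ≠ j ∧ i ≠ k ∧ ori (f (z i)) (f (z' i)) (f (z j)) *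
        ori (f (z i)) (f (z' i)) (f (z k)) < 0 := by
      have t01 := anti 0 1 (by decide)
      have t02 := anti 0 2 (by decide)
      have t12 := anti 1 2 (by decide)
      by_contra hno
      push Not at hno
      have u0 := hno 0 1 2 (by decide) (by decide)
      have u1 := hno 1 0 2 (by decide) (by decide)
      have u2 := hno 2 0 1 (by decide) (by decide)
      have m1 := mul_nonneg (mul_nonneg u0 u1) u2
      have m2 := mul_neg_of_pos_of_neg (mul_pos_of_neg_of_neg t01 t02) t12
      nlinarith
    obtain ⟨i, j, k, hij, hik, hneg⟩ := mid
    obtain ⟨x, x1, x2, x3⟩ := parallel_point (same i j hij) (same j i hij.symm) (anti i j hij)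
      (aC i j hij) (aC j i hij.symm)
    obtain ⟨y, y1, y2, y3⟩ := parallel_point (same i k hik) (same k i hik.symm) (anti i k hik)
      (aC i k hik) (aC k i hik.symm)
    obtain ⟨c, hcC, hc⟩ := hmeet i
    have hout := hrep.2 hcC
    refine diamond (x := x) (y := y) ?_ x1 x2 (by rwa [segment_symm]) (by rwa [segment_symm])
      hc hout.1 hout.2
    by_contra hcon
    have m1 := mul_nonneg (not_lt.mp hcon) (neg_nonneg.mpr hneg.le)
    nlinarith [mul_pos x3 y3]

end
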